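/- Let p ∈ T lie on the Δ-line of slope φ² from P = (φ−1, 0) to Q = (1,1), with p not in the R₀-orbit of 0. Set α = 2−φ and ρ = dist(p, P)/|PQ|. Then {n ∈ ℤ² : R₀ⁿ(p) ∈ Δ} = (M·H_{α,ρ} + supp(B_{φ²})) ∪ (M·V_{α,ρ} + supp(G_{φ²})), where M is the integer matrix with rows (6, −2) and (5, −1), supp(B_{φ²}) = {(0,0),(0,1),(1,1),(1,2),(2,2),(3,2),(3,3),(4,3),(5,3),(5,4),(6,4)}, and supp(G_{φ²}) = {(0,0),(0,1),(1,1),(1,2),(2,2),(3,2),(3,3),(4,3)}. -/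

import Mathlib

noncomputable section

namespace JeandelRao

/-- The golden ratio. -/
def φ : ℝ := (1 + Real.sqrt 5) / 2

/-- The lattice Γ₀ generated by (φ,0) and (1,φ+3). -/
def Γ₀ : AddSubgroup (ℝ × ℝ) := AddSubgroup.closure {(φ, 0), (1, φ + 3)}

/-- The torus T = ℝ²/Γ₀. -/
abbrev T : Type := (ℝ × ℝ) ⧸ Γ₀

/-- The canonical projection ℝ² → ℝ²/Γ₀. -/
def π : ℝ × ℝ → T := QuotientAddGroup.mk

/-- The canonical embedding of ℤ² into ℝ². -/
def ι (n : ℤ × ℤ) : ℝ × ℝ := ((n.1 : ℝ), (n.2 : ℝ))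

/-- The ℤ²-rotation action R₀ⁿ(x) = x + n on the torus T. -/
def R₀ (n : ℤ × ℤ) (x : T) : T := x + π (ι n)

/-- The endpoints of the Δ-lines: the boundary Δ = ⋃ₐ ∂Pₐ of Labbé's polygonal partition
P₀ = {P₀,…,P₁₀} of T is the union of these closed line segments, each of slope
0, φ, φ² or ∞. -/
def ΔLines : List ((ℝ × ℝ) × (ℝ × ℝ)) :=
  [ -- slope 0
    ((0, 0), (φ, 0)), ((0, 1), (φ, 1)),
    -- slope φ
    ((0, 0), (φ - 1, 1)), ((1, 0), (φ, 1)),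
    ((0, 1), (φ - 1, 2)), ((φ - 1, 2), (2*φ - 2, 3)), ((2*φ - 2, 3), (φ, φ + 2)),
    ((1, 1), (φ, 2)),
    ((0, 2), (φ - 1, 3)), ((φ - 1, 3), (1, φ + 2)), ((1, φ + 2), (2*φ - 2, 4)),
    ((2*φ - 2, 4), (φ, φ + 3)),
    ((0, φ + 1), (2*φ - 3, 3)), ((2*φ - 3, 3), (φ - 1, φ + 2)),
    ((2 - φ, φ + 2), (φ - 1, 4)),
    -- slope φ²
    ((φ - 1, 0), (1, 1)),
    ((0, 1), (2 - φ, 2)), ((2 - φ, 2), (4 - 2*φ, 3)), ((4 - 2*φ, 3), (1, φ + 2)),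
    ((φ - 1, 1), (1, 2)), ((1, 2), (3 - φ, 3)), ((3 - φ, 3), (φ, φ + 2)),
    ((0, 2), (2 - φ, 3)), ((2 - φ, 3), (4 - 2*φ, 4)), ((4 - 2*φ, 4), (1, φ + 3)),
    ((0, φ + 2), (5 - 3*φ, 4)), ((5 - 3*φ, 4), (2 - φ, φ + 3)),
    -- slope ∞
    ((0, 0), (0, 1)), ((0, 1), (0, 2)), ((0, 2), (0, 3)), ((0, 3), (0, 4)),
    ((0, 4), (0, φ + 3)),
    ((2 - φ, φ + 2), (2 - φ, 4)), ((2 - φ, 4), (2 - φ, φ + 3)),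
    ((φ - 1, 0), (φ - 1, 1)), ((φ - 1, 1), (φ - 1, 2)),
    ((1, 0), (1, 1)), ((1, 1), (1, 2)),
    ((1, φ + 1), (1, 3)), ((1, 3), (1, 4)), ((1, 4), (1, φ + 3)) ]

/-- The boundary Δ ⊆ ℝ² of the partition P₀ (as a subset of a fundamental domain of T),
i.e. the union of the Δ-lines. -/
def Δ : Set (ℝ × ℝ) := {x | ∃ pq ∈ ΔLines, x ∈ segment ℝ pq.1 pq.2}


/-- The lower mechanical word of slope α and intercept ρ:
s_{α,ρ}(n) = ⌊α(n+1)+ρ⌋ − ⌊αn+ρ⌋. -/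
def mech (α ρ : ℝ) (n : ℤ) : ℤ := ⌊α * (n + 1) + ρ⌋ - ⌊α * n + ρ⌋

/-- H_{α,ρ}: the starting points (n, ⌊αn+ρ⌋) of the horizontal steps of the lower
mechanical line of slope α and intercept ρ. -/
def Hset (α ρ : ℝ) : Set (ℤ × ℤ) :=
  {m | m.2 = ⌊α * m.1 + ρ⌋ ∧ mech α ρ m.1 = 0}

/-- V_{α,ρ}: the starting points (n, ⌊αn+ρ⌋) of the diagonal steps of the lower
mechanical line of slope α and intercept ρ. -/
def Vset (α ρ : ℝ) : Set (ℤ × ℤ) :=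
  {m | m.2 = ⌊α * m.1 + ρ⌋ ∧ mech α ρ m.1 = 1}

/-- The support of the pattern Bφsq. -/
def suppBφsq : Set (ℤ × ℤ) := {(0,0),(0,1),(1,1),(1,2),(2,2),(3,2),(3,3),(4,3),(5,3),(5,4),(6,4)}

/-- The support of the pattern Gφsq. -/
def suppGφsq : Set (ℤ × ℤ) := {(0,0),(0,1),(1,1),(1,2),(2,2),(3,2),(3,3),(4,3)}

theorem phi_sq : φ ^ 2 = φ + 1 := Real.goldenRatio_sq

theorem one_lt_phi : 1 < φ := Real.one_lt_goldenRatio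

theorem phi_lt_two : φ < 2 := Real.goldenRatio_lt_two

/-- The ring `ℤ[φ]`, as a subring of `ℝ`. -/
def goldenIntegers : Subring ℝ where
  carrier := {x | ∃ a b : ℤ, x = a + b * φ}
  zero_mem' := ⟨0, 0, by simp⟩
  one_mem' := ⟨1, 0, by simp⟩
  add_mem' := by
    rintro _ _ ⟨a, b, rfl⟩ ⟨c, d, rfl⟩
    exact ⟨a + c, b + d, by push_cast; ring⟩
  neg_mem' := by
    rintro _ ⟨a, b, rfl⟩
    exact ⟨-a, -b, by push_cast; ring⟩
  mul_mem' := by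
    rintro _ _ ⟨a, b, rfl⟩ ⟨c, d, rfl⟩
    exact ⟨a * c + b * d, a * d + b * c + b * d, by
      push_cast; linear_combination (b * d : ℝ) * phi_sq⟩

theorem mem_goldenIntegers {x : ℝ} : x ∈ goldenIntegers ↔ ∃ a b : ℤ, x = a + b * φ := Iff.rfl

theorem phi_mem : φ ∈ goldenIntegers := ⟨0, 1, by simp⟩

theorem intCast_add_mul_phi_inj {a b c d : ℤ} (h : (a : ℝ) + b * φ = c + d * φ) :
    a = c ∧ b = d := by
  have hbd : b = d := by
    by_contra hne
    have hne' : (b : ℝ) - d ≠ 0 := sub_ne_zero.2 (by exact_mod_cast hne)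
    refine Real.goldenRatio_irrational ⟨((c - a : ℤ) : ℚ) / ((b - d : ℤ) : ℚ), ?_⟩
    change _ = φ
    push_cast
    rw [div_eq_iff hne']
    linear_combination -h
  subst hbd
  exact ⟨by exact_mod_cast add_right_cancel h, rfl⟩

theorem mem_Γ₀ {x : ℝ × ℝ} :
    x ∈ Γ₀ ↔ ∃ i j : ℤ, x = (i * φ + j, j * (φ + 3)) := by
  simp [Γ₀, AddSubgroup.mem_closure_pair, eq_comm, mul_add]

theorem π_eq_iff {x y : ℝ × ℝ} :
    π x = π y ↔ ∃ i j : ℤ, y = (x.1 + i * φ + j, x.2 + j * (φ + 3)) := by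
  rw [π, QuotientAddGroup.eq, mem_Γ₀]
  refine exists₂_congr fun i j => ?_
  simp only [Prod.ext_iff, Prod.fst_add, Prod.snd_add, Prod.fst_neg, Prod.snd_neg]
  constructor <;> rintro ⟨h₁, h₂⟩ <;> constructor <;> linarith

theorem R₀_π (n : ℤ × ℤ) (x : ℝ × ℝ) : R₀ n (π x) = π (x + ι n) := rfl

theorem mem_segment_iff_exists {A B x : ℝ × ℝ} :
    x ∈ segment ℝ A B ↔ ∃ s : ℝ, 0 ≤ s ∧ s ≤ 1 ∧
      x = (A.1 + s * (B.1 - A.1), A.2 + s * (B.2 - A.2)) := by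
  rw [segment_eq_image']
  simp [Set.mem_image, Prod.ext_iff, and_assoc, eq_comm]

/-- Membership in a non-degenerate segment of slope `φ²`, whose inverse slope is `2 - φ`. -/
theorem mem_segment_iff_of_slope_phi_sq {A B x : ℝ × ℝ} (hAB : A.2 < B.2)
    (hslope : B.1 - A.1 = (2 - φ) * (B.2 - A.2)) :
    x ∈ segment ℝ A B ↔ A.2 ≤ x.2 ∧ x.2 ≤ B.2 ∧ x.1 - A.1 = (2 - φ) * (x.2 - A.2) := by
  rw [mem_segment_iff_exists]
  constructor
  · rintro ⟨s, hs₀, hs₁, rfl⟩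
    refine ⟨by nlinarith, by nlinarith, ?_⟩
    linear_combination s * hslope
  · rintro ⟨h₁, h₂, h₃⟩
    have hpos : 0 < B.2 - A.2 := sub_pos.2 hAB
    refine ⟨(x.2 - A.2) / (B.2 - A.2), div_nonneg (by linarith) hpos.le,
      (div_le_one hpos).2 (by linarith), ?_⟩
    ext
    · rw [hslope]
      field_simp
      linarith
    · field_simp
      ring

/-- The union of the maximal segments of slope `φ²` contained in `Δ`. -/
def slopePhiSqPart : Set (ℝ × ℝ) :=
  segment ℝ (φ - 1, 0) (1, 1) ∪ segment ℝ (0, 1) (1, φ + 2) ∪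
    segment ℝ (φ - 1, 1) (φ, φ + 2) ∪ segment ℝ (0, 2) (1, φ + 3) ∪
    segment ℝ (0, φ + 2) (2 - φ, φ + 3)

theorem slopePhiSqPart_subset_Δ : slopePhiSqPart ⊆ Δ := by
  have h₁ := one_lt_phi
  have h₂ := phi_lt_two
  have h₃ := phi_sq
  have key {A B x : ℝ × ℝ} (hΔ : (A, B) ∈ ΔLines) (hAB : A.2 < B.2)
      (hslope : B.1 - A.1 = (2 - φ) * (B.2 - A.2)) (hA : A.2 ≤ x.2) (hB : x.2 ≤ B.2)
      (hx : x.1 - A.1 = (2 - φ) * (x.2 - A.2)) : x ∈ Δ :=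
    ⟨(A, B), hΔ, (mem_segment_iff_of_slope_phi_sq hAB hslope).2 ⟨hA, hB, hx⟩⟩
  rintro ⟨x, y⟩ ((((h | h) | h) | h) | h)
  · exact ⟨((φ - 1, 0), (1, 1)), by simp [ΔLines], h⟩
  all_goals
    rw [mem_segment_iff_of_slope_phi_sq (by dsimp only; linarith) (by dsimp only; nlinarith)] at h
    dsimp only at h
    obtain ⟨ha, hb, hc⟩ := h
  · rcases le_total y 2 with h | h
    · exact key (A := (0, 1)) (B := (2 - φ, 2)) (by simp [ΔLines]) (by dsimp only; linarith)
        (by dsimp only; nlinarith) (by dsimp only; linarith) (by dsimp only; linarith)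
        (by dsimp only; nlinarith)
    rcases le_total y 3 with h' | h'
    · exact key (A := (2 - φ, 2)) (B := (4 - 2 * φ, 3)) (by simp [ΔLines])
        (by dsimp only; linarith) (by dsimp only; nlinarith) (by dsimp only; linarith)
        (by dsimp only; linarith) (by dsimp only; nlinarith)
    · exact key (A := (4 - 2 * φ, 3)) (B := (1, φ + 2)) (by simp [ΔLines])
        (by dsimp only; linarith) (by dsimp only; nlinarith) (by dsimp only; linarith)
        (by dsimp only; linarith) (by dsimp only; nlinarith)
  · rcases le_total y 2 with h | h
    · exact key (A := (φ - 1, 1)) (B := (1, 2)) (by simp [ΔLines]) (by dsimp only; linarith)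
        (by dsimp only; nlinarith) (by dsimp only; linarith) (by dsimp only; linarith)
        (by dsimp only; nlinarith)
    rcases le_total y 3 with h' | h'
    · exact key (A := (1, 2)) (B := (3 - φ, 3)) (by simp [ΔLines])
        (by dsimp only; linarith) (by dsimp only; nlinarith) (by dsimp only; linarith)
        (by dsimp only; linarith) (by dsimp only; nlinarith)
    · exact key (A := (3 - φ, 3)) (B := (φ, φ + 2)) (by simp [ΔLines])
        (by dsimp only; linarith) (by dsimp only; nlinarith) (by dsimp only; linarith)
        (by dsimp only; linarith) (by dsimp only; nlinarith)
  · rcases le_total y 3 with h | h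
    · exact key (A := (0, 2)) (B := (2 - φ, 3)) (by simp [ΔLines]) (by dsimp only; linarith)
        (by dsimp only; nlinarith) (by dsimp only; linarith) (by dsimp only; linarith)
        (by dsimp only; nlinarith)
    rcases le_total y 4 with h' | h'
    · exact key (A := (2 - φ, 3)) (B := (4 - 2 * φ, 4)) (by simp [ΔLines])
        (by dsimp only; linarith) (by dsimp only; nlinarith) (by dsimp only; linarith)
        (by dsimp only; linarith) (by dsimp only; nlinarith)
    · exact key (A := (4 - 2 * φ, 4)) (B := (1, φ + 3)) (by simp [ΔLines])
        (by dsimp only; linarith) (by dsimp only; nlinarith) (by dsimp only; linarith)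
        (by dsimp only; linarith) (by dsimp only; nlinarith)
  · rcases le_total y 4 with h | h
    · exact key (A := (0, φ + 2)) (B := (5 - 3 * φ, 4)) (by simp [ΔLines])
        (by dsimp only; linarith) (by dsimp only; nlinarith) (by dsimp only; linarith)
        (by dsimp only; linarith) (by dsimp only; nlinarith)
    · exact key (A := (5 - 3 * φ, 4)) (B := (2 - φ, φ + 3)) (by simp [ΔLines])
        (by dsimp only; linarith) (by dsimp only; nlinarith) (by dsimp only; linarith)
        (by dsimp only; linarith) (by dsimp only; nlinarith)

theorem endpoints_mem_goldenIntegers :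
    ∀ l ∈ ΔLines, l.1.1 ∈ goldenIntegers ∧ l.1.2 ∈ goldenIntegers := by
  simp only [ΔLines, List.forall_mem_cons, List.not_mem_nil, false_implies, implies_true, and_true]
  refine ⟨?_, ?_, ?_, ?_, ?_, ?_, ?_, ?_, ?_, ?_, ?_, ?_, ?_, ?_, ?_, ?_, ?_, ?_, ?_, ?_, ?_, ?_,
    ?_, ?_, ?_, ?_, ?_, ?_, ?_, ?_, ?_, ?_, ?_, ?_, ?_, ?_, ?_, ?_, ?_, ?_, ?_⟩ <;>
  constructor <;>
  repeat' first
    | exact phi_mem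
    | exact zero_mem _
    | exact one_mem _
    | exact ofNat_mem _ _
    | apply sub_mem
    | apply add_mem
    | apply mul_mem

theorem segment_subset_slopePhiSqPart {A B A' B' : ℝ × ℝ}
    (hsub : segment ℝ A' B' ⊆ slopePhiSqPart) (hAB : A'.2 < B'.2)
    (hslope : B'.1 - A'.1 = (2 - φ) * (B'.2 - A'.2))
    (hA₁ : A'.2 ≤ A.2) (hA₂ : A.2 ≤ B'.2) (hA : A.1 - A'.1 = (2 - φ) * (A.2 - A'.2))
    (hB₁ : A'.2 ≤ B.2) (hB₂ : B.2 ≤ B'.2) (hB : B.1 - A'.1 = (2 - φ) * (B.2 - A'.2)) :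
    segment ℝ A B ⊆ slopePhiSqPart :=
  ((convex_segment A' B').segment_subset
    ((mem_segment_iff_of_slope_phi_sq hAB hslope).2 ⟨hA₁, hA₂, hA⟩)
    ((mem_segment_iff_of_slope_phi_sq hAB hslope).2 ⟨hB₁, hB₂, hB⟩)).trans hsub

theorem slope_or_subset_slopePhiSqPart :
    ∀ l ∈ ΔLines, l.2.2 = l.1.2 ∨ l.2.1 = l.1.1 ∨ l.2.2 - l.1.2 = φ * (l.2.1 - l.1.1) ∨
      segment ℝ l.1 l.2 ⊆ slopePhiSqPart := by
  have h₁ := one_lt_phi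
  have h₂ := phi_lt_two
  have h₃ := phi_sq
  have s₁ : segment ℝ (φ - 1, 0) (1, 1) ⊆ slopePhiSqPart := fun _ h => .inl (.inl (.inl (.inl h)))
  have s₂ : segment ℝ (0, 1) (1, φ + 2) ⊆ slopePhiSqPart := fun _ h => .inl (.inl (.inl (.inr h)))
  have s₃ : segment ℝ (φ - 1, 1) (φ, φ + 2) ⊆ slopePhiSqPart := fun _ h => .inl (.inl (.inr h))
  have s₄ : segment ℝ (0, 2) (1, φ + 3) ⊆ slopePhiSqPart := fun _ h => .inl (.inr h)
  have s₅ : segment ℝ (0, φ + 2) (2 - φ, φ + 3) ⊆ slopePhiSqPart := fun _ h => .inr h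
  simp only [ΔLines, List.forall_mem_cons, List.not_mem_nil, false_implies, implies_true, and_true]
  refine ⟨?_, ?_, ?_, ?_, ?_, ?_, ?_, ?_, ?_, ?_, ?_, ?_, ?_, ?_, ?_, .inr (.inr (.inr s₁)),
    .inr (.inr (.inr (segment_subset_slopePhiSqPart s₂ ?_ ?_ ?_ ?_ ?_ ?_ ?_ ?_))),
    .inr (.inr (.inr (segment_subset_slopePhiSqPart s₂ ?_ ?_ ?_ ?_ ?_ ?_ ?_ ?_))),
    .inr (.inr (.inr (segment_subset_slopePhiSqPart s₂ ?_ ?_ ?_ ?_ ?_ ?_ ?_ ?_))),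
    .inr (.inr (.inr (segment_subset_slopePhiSqPart s₃ ?_ ?_ ?_ ?_ ?_ ?_ ?_ ?_))),
    .inr (.inr (.inr (segment_subset_slopePhiSqPart s₃ ?_ ?_ ?_ ?_ ?_ ?_ ?_ ?_))),
    .inr (.inr (.inr (segment_subset_slopePhiSqPart s₃ ?_ ?_ ?_ ?_ ?_ ?_ ?_ ?_))),
    .inr (.inr (.inr (segment_subset_slopePhiSqPart s₄ ?_ ?_ ?_ ?_ ?_ ?_ ?_ ?_))),
    .inr (.inr (.inr (segment_subset_slopePhiSqPart s₄ ?_ ?_ ?_ ?_ ?_ ?_ ?_ ?_))),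
    .inr (.inr (.inr (segment_subset_slopePhiSqPart s₄ ?_ ?_ ?_ ?_ ?_ ?_ ?_ ?_))),
    .inr (.inr (.inr (segment_subset_slopePhiSqPart s₅ ?_ ?_ ?_ ?_ ?_ ?_ ?_ ?_))),
    .inr (.inr (.inr (segment_subset_slopePhiSqPart s₅ ?_ ?_ ?_ ?_ ?_ ?_ ?_ ?_))),
    ?_, ?_, ?_, ?_, ?_, ?_, ?_, ?_, ?_, ?_, ?_, ?_, ?_, ?_⟩
  all_goals first
    | exact .inl trivial
    | exact .inr (.inl trivial)
    | exact .inr (.inr (.inl (by nlinarith)))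
    | nlinarith

theorem slope_cases_of_mem_Δ {x : ℝ × ℝ} (hx : x ∈ Δ) :
    x.2 ∈ goldenIntegers ∨ x.1 ∈ goldenIntegers ∨ x.2 - φ * x.1 ∈ goldenIntegers ∨
      x ∈ slopePhiSqPart := by
  obtain ⟨l, hl, hxl⟩ := hx
  obtain ⟨h₁, h₂⟩ := endpoints_mem_goldenIntegers l hl
  rcases slope_or_subset_slopePhiSqPart l hl with h | h | h | h
  · obtain ⟨s, -, -, rfl⟩ := mem_segment_iff_exists.1 hxl
    exact .inl (by simpa [h] using h₂)
  · obtain ⟨s, -, -, rfl⟩ := mem_segment_iff_exists.1 hxl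
    exact .inr (.inl (by simpa [h] using h₁))
  · obtain ⟨s, -, -, rfl⟩ := mem_segment_iff_exists.1 hxl
    refine .inr (.inr (.inl ?_))
    convert sub_mem h₂ (mul_mem phi_mem h₁) using 1
    linear_combination s * h
  · exact .inr (.inr (.inr (h hxl)))

/-- Some lattice point `(a, b)` at height `t + a + b * φ` in `[0, h]` is sent to `n` by the affine
map with offset `c`. -/
def HitWithOffset (c : ℤ × ℤ) (h t : ℝ) (n : ℤ × ℤ) : Prop :=
  ∃ a b : ℤ, n = (2 * a - 2 * b + c.1, a - 3 * b + c.2) ∧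
    0 ≤ t + a + b * φ ∧ t + a + b * φ ≤ h

theorem exists_translate_mem_segment_iff (t : ℝ) (n : ℤ × ℤ) {c : ℤ × ℤ} {h : ℝ}
    (A₀ A₁ B₀ B₁ : ℤ) {A B : ℝ × ℝ} (hA : A = (A₀ + A₁ * φ, B₀ + B₁ * φ)) (hAB : A.2 < B.2)
    (hslope : B.1 - A.1 = (2 - φ) * (B.2 - A.2))
    (hc : c = (1 + A₀ - B₁, B₀ - 3 * B₁)) (hh : B.2 = A.2 + h) :
    (∃ i j : ℤ, (φ - 1 + t * (2 - φ) + n.1 + i * φ + j, t + n.2 + j * (φ + 3)) ∈ segment ℝ A B) ↔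
      HitWithOffset c h t n := by
  simp only [mem_segment_iff_of_slope_phi_sq hAB hslope, HitWithOffset, hh]
  subst hA hc
  obtain ⟨n₁, n₂⟩ := n
  simp only [Prod.mk.injEq]
  constructor
  · rintro ⟨i, j, h₁, h₂, h₃⟩
    have key : ((n₁ - 1 + j - A₀ : ℤ) : ℝ) + ((1 + i - A₁ : ℤ) : ℝ) * φ =
        ((2 * (n₂ + 3 * j - B₀) - (j - B₁) : ℤ) : ℝ) +
          (((j - B₁) - (n₂ + 3 * j - B₀) : ℤ) : ℝ) * φ := by
      push_cast
      linear_combination h₃ - ((j : ℝ) - B₁) * phi_sq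
    obtain ⟨h₄, -⟩ := intCast_add_mul_phi_inj key
    refine ⟨n₂ + 3 * j - B₀, j - B₁, ⟨by linarith, by ring⟩, ?_, ?_⟩ <;> push_cast <;> linarith
  · rintro ⟨a, b, ⟨rfl, rfl⟩, h₁, h₂⟩
    refine ⟨b - a - 1 + A₁, b + B₁, ?_, ?_, ?_⟩ <;> push_cast
    · linarith
    · linarith
    · linear_combination (b : ℝ) * phi_sq

/-- The visits of the orbit to `Δ`, sorted by the maximal segment that is hit. -/
theorem R₀_mem_image_Δ_iff {t : ℝ} (ht : t ∉ goldenIntegers) (n : ℤ × ℤ) :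
    R₀ n (π (φ - 1 + t * (2 - φ), t)) ∈ π '' Δ ↔
      HitWithOffset (0, 0) 1 t n ∨ HitWithOffset (1, 1) (φ + 1) t n ∨
      HitWithOffset (0, 1) (φ + 1) t n ∨ HitWithOffset (1, 2) (φ + 1) t n ∨
      HitWithOffset (0, -1) 1 t n := by
  have h₁ := one_lt_phi
  have h₃ := phi_sq
  have hΔ : R₀ n (π (φ - 1 + t * (2 - φ), t)) ∈ π '' Δ ↔ ∃ i j : ℤ,
      (φ - 1 + t * (2 - φ) + n.1 + i * φ + j, t + n.2 + j * (φ + 3)) ∈ slopePhiSqPart := by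
    rw [R₀_π]
    constructor
    · rintro ⟨x, hx, hxn⟩
      obtain ⟨i, j, rfl⟩ := π_eq_iff.1 hxn.symm
      refine ⟨i, j, ?_⟩
      rcases slope_cases_of_mem_Δ hx with h | h | h | h
      · obtain ⟨a, b, h⟩ := h
        refine absurd ⟨a - n.2 - 3 * j, b - j, ?_⟩ ht
        simp only [ι, Prod.mk_add_mk] at h
        push_cast
        linear_combination h
      · obtain ⟨a, b, h⟩ := h
        have hmem : t = (1 + φ) * (a + b * φ - φ + 1 - n.1 - i * φ - j) := by
          simp only [ι, Prod.mk_add_mk] at h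
          linear_combination (1 + φ) * h + t * phi_sq
        refine absurd ?_ ht
        rw [hmem]
        exact mul_mem (add_mem (one_mem _) phi_mem)
          ⟨a + 1 - n.1 - j, b - 1 - i, by push_cast; ring⟩
      · obtain ⟨a, b, h⟩ := h
        have hmem : t = (1 + φ) *
            (a + b * φ - n.2 - j * (φ + 3) + φ * (φ - 1 + n.1 + i * φ + j)) := by
          simp only [ι, Prod.mk_add_mk] at h
          linear_combination (1 + φ) * h - t * φ * phi_sq
        refine absurd ?_ ht
        rw [hmem]
        refine mul_mem (add_mem (one_mem _) phi_mem) ?_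
        have hint (m : ℤ) : (m : ℝ) ∈ goldenIntegers := intCast_mem _ m
        have h3 : (3 : ℝ) ∈ goldenIntegers := ofNat_mem _ 3
        exact add_mem (sub_mem (sub_mem (add_mem (hint a) (mul_mem (hint b) phi_mem)) (hint _))
          (mul_mem (hint j) (add_mem phi_mem h3))) (mul_mem phi_mem (add_mem (add_mem (add_mem
          (sub_mem phi_mem (one_mem _)) (hint _)) (mul_mem (hint i) phi_mem)) (hint j)))
      · exact h
    · rintro ⟨i, j, h⟩
      exact ⟨_, slopePhiSqPart_subset_Δ h,
        (π_eq_iff.2 ⟨i, j, by simp [ι]⟩).symm⟩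
  have e₁ := exists_translate_mem_segment_iff t n (c := (0, 0)) (h := 1)
    (-1) 1 0 0 (A := (φ - 1, 0)) (B := (1, 1))
    (by ext <;> push_cast <;> ring)
    (by dsimp only; linarith) (by dsimp only; nlinarith) (by norm_num) (by dsimp only; ring)
  have e₂ := exists_translate_mem_segment_iff t n (c := (1, 1)) (h := φ + 1)
    0 0 1 0 (A := (0, 1)) (B := (1, φ + 2))
    (by ext <;> push_cast <;> ring)
    (by dsimp only; linarith) (by dsimp only; nlinarith) (by norm_num) (by dsimp only; ring)
  have e₃ := exists_translate_mem_segment_iff t n (c := (0, 1)) (h := φ + 1)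
    (-1) 1 1 0 (A := (φ - 1, 1)) (B := (φ, φ + 2))
    (by ext <;> push_cast <;> ring)
    (by dsimp only; linarith) (by dsimp only; nlinarith) (by norm_num) (by dsimp only; ring)
  have e₄ := exists_translate_mem_segment_iff t n (c := (1, 2)) (h := φ + 1)
    0 0 2 0 (A := (0, 2)) (B := (1, φ + 3))
    (by ext <;> push_cast <;> ring)
    (by dsimp only; linarith) (by dsimp only; nlinarith) (by norm_num) (by dsimp only; ring)
  have e₅ := exists_translate_mem_segment_iff t n (c := (0, -1)) (h := 1)
    0 0 2 1 (A := (0, φ + 2)) (B := (2 - φ, φ + 3))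
    (by ext <;> push_cast <;> ring)
    (by dsimp only; linarith) (by dsimp only; nlinarith) (by norm_num) (by dsimp only; ring)
  rw [hΔ]
  simp only [slopePhiSqPart, Set.mem_union, exists_or, e₁, e₂, e₃, e₄, e₅, or_assoc]

theorem mem_Hset_iff {ρ : ℝ} {m : ℤ × ℤ} :
    m ∈ Hset (2 - φ) ρ ↔ 0 ≤ (2 - φ) * m.1 + ρ - m.2 ∧ (2 - φ) * m.1 + ρ - m.2 < φ - 1 := by
  have h₂ := phi_lt_two
  simp only [Hset, mech, Set.mem_ofPred_eq]
  constructor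
  · rintro ⟨h, h'⟩
    rw [← h, sub_eq_zero, Int.floor_eq_iff] at h'
    have := Int.floor_eq_iff.1 h.symm
    constructor <;> linarith
  · rintro ⟨h, h'⟩
    have : ⌊(2 - φ) * m.1 + ρ⌋ = m.2 := Int.floor_eq_iff.2 ⟨by linarith, by linarith⟩
    rw [this, sub_eq_zero, Int.floor_eq_iff]
    exact ⟨rfl, by linarith, by linarith⟩

theorem mem_Vset_iff {ρ : ℝ} {m : ℤ × ℤ} :
    m ∈ Vset (2 - φ) ρ ↔ φ - 1 ≤ (2 - φ) * m.1 + ρ - m.2 ∧ (2 - φ) * m.1 + ρ - m.2 < 1 := by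
  have h₁ := one_lt_phi
  simp only [Vset, mech, Set.mem_ofPred_eq]
  constructor
  · rintro ⟨h, h'⟩
    rw [← h, sub_eq_iff_eq_add, Int.floor_eq_iff] at h'
    push_cast at h'
    have := Int.floor_eq_iff.1 h.symm
    constructor <;> linarith
  · rintro ⟨h, h'⟩
    have : ⌊(2 - φ) * m.1 + ρ⌋ = m.2 := Int.floor_eq_iff.2 ⟨by linarith, by linarith⟩
    rw [this, sub_eq_iff_eq_add, Int.floor_eq_iff]
    push_cast
    exact ⟨rfl, by linarith, by linarith⟩

theorem exists_mem_Hset_iff {ρ : ℝ} {n : ℤ × ℤ} {S : Set (ℤ × ℤ)} :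
    (∃ a ∈ Hset (2 - φ) ρ, ∃ s ∈ S,
        n = (6 * a.1 + (-2) * a.2 + s.1, 5 * a.1 + (-1) * a.2 + s.2)) ↔
      ∃ a b : ℤ, 0 ≤ ρ + a + b * φ ∧ ρ + a + b * φ < φ - 1 ∧
        (n.1 - (2 * a - 2 * b), n.2 - (a - 3 * b)) ∈ S := by
  constructor
  · rintro ⟨m, hm, s, hs, rfl⟩
    rw [mem_Hset_iff] at hm
    refine ⟨2 * m.1 - m.2, -m.1, by push_cast; linarith, by push_cast; linarith, ?_⟩
    convert hs using 1
    ext <;> dsimp only <;> ring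
  · rintro ⟨a, b, h₁, h₂, hs⟩
    refine ⟨(-b, -2 * b - a), mem_Hset_iff.2 ?_, _, hs, ?_⟩
    · push_cast
      constructor <;> linarith
    · ext <;> dsimp only <;> ring

theorem exists_mem_Vset_iff {ρ : ℝ} {n : ℤ × ℤ} {S : Set (ℤ × ℤ)} :
    (∃ a ∈ Vset (2 - φ) ρ, ∃ s ∈ S,
        n = (6 * a.1 + (-2) * a.2 + s.1, 5 * a.1 + (-1) * a.2 + s.2)) ↔
      ∃ a b : ℤ, φ - 1 ≤ ρ + a + b * φ ∧ ρ + a + b * φ < 1 ∧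
        (n.1 - (2 * a - 2 * b), n.2 - (a - 3 * b)) ∈ S := by
  constructor
  · rintro ⟨m, hm, s, hs, rfl⟩
    rw [mem_Vset_iff] at hm
    refine ⟨2 * m.1 - m.2, -m.1, by push_cast; linarith, by push_cast; linarith, ?_⟩
    convert hs using 1
    ext <;> dsimp only <;> ring
  · rintro ⟨a, b, h₁, h₂, hs⟩
    refine ⟨(-b, -2 * b - a), mem_Vset_iff.2 ?_, _, hs, ?_⟩
    · push_cast
      constructor <;> linarith
    · ext <;> dsimp only <;> ring

/-- `n` lies in the copy of the pattern `B` or `G` attached to some lattice point `(a, b)` at height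
`t + a + b * φ` in `[0, φ - 1)` or `[φ - 1, 1)`, respectively. -/
def HitByPattern (t : ℝ) (n : ℤ × ℤ) : Prop :=
    (∃ a b : ℤ, 0 ≤ t + a + b * φ ∧ t + a + b * φ < φ - 1 ∧
        (n.1 - (2 * a - 2 * b), n.2 - (a - 3 * b)) ∈ suppBφsq) ∨
      ∃ a b : ℤ, φ - 1 ≤ t + a + b * φ ∧ t + a + b * φ < 1 ∧
        (n.1 - (2 * a - 2 * b), n.2 - (a - 3 * b)) ∈ suppGφsq

/-- The patterns `B` and `G` cover exactly the lattice points that hit some maximal segment. -/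
theorem hit_iff_pattern {t : ℝ} (ht : t ∉ goldenIntegers) (n : ℤ × ℤ) :
    (HitWithOffset (0, 0) 1 t n ∨ HitWithOffset (1, 1) (φ + 1) t n ∨
      HitWithOffset (0, 1) (φ + 1) t n ∨ HitWithOffset (1, 2) (φ + 1) t n ∨
      HitWithOffset (0, -1) 1 t n) ↔ HitByPattern t n := by
  have h₁ := one_lt_phi
  have h₂ := phi_lt_two
  obtain ⟨n₁, n₂⟩ := n
  constructor
  · have hB {a b : ℤ} (s : ℤ × ℤ) (hs : s ∈ suppBφsq)
        (hn : (n₁, n₂) = (2 * a - 2 * b + s.1, a - 3 * b + s.2))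
        (h₀ : 0 ≤ t + a + b * φ) (h : t + a + b * φ < φ - 1) :
        ∃ a b : ℤ, 0 ≤ t + a + b * φ ∧ t + a + b * φ < φ - 1 ∧
          (n₁ - (2 * a - 2 * b), n₂ - (a - 3 * b)) ∈ suppBφsq := by
      refine ⟨a, b, h₀, h, ?_⟩
      obtain ⟨rfl, rfl⟩ := Prod.mk.inj hn
      simpa using hs
    have hG {a b : ℤ} (s : ℤ × ℤ) (hs : s ∈ suppGφsq)
        (hn : (n₁, n₂) = (2 * a - 2 * b + s.1, a - 3 * b + s.2))
        (h₀ : φ - 1 ≤ t + a + b * φ) (h : t + a + b * φ < 1) :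
        ∃ a b : ℤ, φ - 1 ≤ t + a + b * φ ∧ t + a + b * φ < 1 ∧
          (n₁ - (2 * a - 2 * b), n₂ - (a - 3 * b)) ∈ suppGφsq := by
      refine ⟨a, b, h₀, h, ?_⟩
      obtain ⟨rfl, rfl⟩ := Prod.mk.inj hn
      simpa using hs
    have hBG {a b : ℤ} (s : ℤ × ℤ) (hsG : s ∈ suppGφsq) (hsB : s ∈ suppBφsq)
        (hn : (n₁, n₂) = (2 * a - 2 * b + s.1, a - 3 * b + s.2))
        (h₀ : 0 ≤ t + a + b * φ) (h : t + a + b * φ < 1) : HitByPattern t (n₁, n₂) :=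
      (lt_or_ge (t + a + b * φ) (φ - 1)).imp (hB s hsB hn h₀) (hG s hsG hn · h)
    have hlt_one {a b : ℤ} (h : t + a + b * φ ≤ 1) : t + a + b * φ < 1 :=
      h.lt_of_ne fun h => ht ⟨1 - a, -b, by push_cast; linarith⟩
    have hlt_phi {a b : ℤ} (h : t + a + b * φ ≤ φ + 1) : t + a + b * φ < φ + 1 :=
      h.lt_of_ne fun h => ht ⟨1 - a, 1 - b, by push_cast; linarith⟩
    have hlong (s : ℤ × ℤ) (hs₀G : s ∈ suppGφsq) (hs₀B : s ∈ suppBφsq)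
        (hs₁G : s + (2, 1) ∈ suppGφsq) (hs₁B : s + (2, 1) ∈ suppBφsq)
        (hs₂B : s + (4, 2) ∈ suppBφsq) (hit : HitWithOffset s (φ + 1) t (n₁, n₂)) :
        HitByPattern t (n₁, n₂) := by
      obtain ⟨a, b, hn, h₀, h⟩ := hit
      rcases lt_or_ge (t + a + b * φ) 1 with h' | h'
      · exact hBG s hs₀G hs₀B hn h₀ h'
      rcases lt_or_ge (t + a + b * φ) 2 with h'' | h''
      · refine hBG (a := a - 1) (b := b) _ hs₁G hs₁B ?_ ?_ ?_
        · rw [hn]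
          ext <;> dsimp only [Prod.fst_add, Prod.snd_add] <;> ring
        all_goals push_cast; linarith
      · refine .inl (hB (a := a - 2) (b := b) _ hs₂B ?_ ?_ ?_)
        · rw [hn]
          ext <;> dsimp only [Prod.fst_add, Prod.snd_add] <;> ring
        all_goals push_cast; linarith [hlt_phi h]
    rintro (⟨a, b, hn, h₀, h⟩ | h | h | h | ⟨a, b, hn, h₀, h⟩)
    · exact hBG (0, 0) (by simp [suppGφsq]) (by simp [suppBφsq]) hn h₀ (hlt_one h)
    · exact hlong _ (by simp [suppGφsq]) (by simp [suppBφsq]) (by simp [suppGφsq])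
        (by simp [suppBφsq]) (by simp [suppBφsq]) h
    · exact hlong _ (by simp [suppGφsq]) (by simp [suppBφsq]) (by simp [suppGφsq])
        (by simp [suppBφsq]) (by simp [suppBφsq]) h
    · exact hlong _ (by simp [suppGφsq]) (by simp [suppBφsq]) (by simp [suppGφsq])
        (by simp [suppBφsq]) (by simp [suppBφsq]) h
    · rcases lt_or_ge (t + a + b * φ) (2 - φ) with h' | h'
      · refine .inr (hG (a := a - 1) (b := b + 1) (4, 3) (by simp [suppGφsq]) ?_ ?_ ?_)
        · rw [hn]
          ext <;> dsimp only <;> ring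
        all_goals push_cast; linarith
      · refine .inl (hB (a := a - 2) (b := b + 1) (6, 4) (by simp [suppBφsq]) ?_ ?_ ?_)
        · rw [hn]
          ext <;> dsimp only <;> ring
        all_goals push_cast; linarith [hlt_one h]
  · have hit {a b : ℤ} (c s : ℤ × ℤ) (a' b' : ℤ) (h : ℝ)
        (hs : n₁ - (2 * a - 2 * b) = s.1 ∧ n₂ - (a - 3 * b) = s.2)
        (hsc : s = (2 * a' - 2 * b' + c.1, a' - 3 * b' + c.2))
        (hv₀ : 0 ≤ t + a + b * φ + a' + b' * φ) (hv : t + a + b * φ + a' + b' * φ ≤ h) :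
        HitWithOffset c h t (n₁, n₂) := by
      subst hsc
      refine ⟨a + a', b + b', ?_, by push_cast; linarith, by push_cast; linarith⟩
      ext <;> dsimp only at hs ⊢
      · linarith [hs.1]
      · linarith [hs.2]
    rintro (⟨a, b, h₀, h, hs⟩ | ⟨a, b, h₀, h, hs⟩)
    · simp only [suppBφsq, Set.mem_insert_iff, Set.mem_singleton_iff, Prod.mk.injEq] at hs
      rcases hs with hs | hs | hs | hs | hs | hs | hs | hs | hs | hs | hs
      · exact .inl (hit _ (0, 0) 0 0 _ hs rfl (by norm_num; linarith) (by norm_num; linarith))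
      · exact .inr (.inr (.inl (hit _ (0, 1) 0 0 _ hs rfl (by norm_num; linarith)
          (by norm_num; linarith))))
      · exact .inr (.inl (hit _ (1, 1) 0 0 _ hs rfl (by norm_num; linarith)
          (by norm_num; linarith)))
      · exact .inr (.inr (.inr (.inl (hit _ (1, 2) 0 0 _ hs rfl (by norm_num; linarith)
          (by norm_num; linarith)))))
      · exact .inr (.inr (.inl (hit _ (2, 2) 1 0 _ hs rfl (by norm_num; linarith)
          (by norm_num; linarith))))
      · exact .inr (.inl (hit _ (3, 2) 1 0 _ hs rfl (by norm_num; linarith)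
          (by norm_num; linarith)))
      · exact .inr (.inr (.inr (.inl (hit _ (3, 3) 1 0 _ hs rfl (by norm_num; linarith)
          (by norm_num; linarith)))))
      · exact .inr (.inr (.inl (hit _ (4, 3) 2 0 _ hs rfl (by norm_num; linarith)
          (by norm_num; linarith))))
      · exact .inr (.inl (hit _ (5, 3) 2 0 _ hs rfl (by norm_num; linarith)
          (by norm_num; linarith)))
      · exact .inr (.inr (.inr (.inl (hit _ (5, 4) 2 0 _ hs rfl (by norm_num; linarith)
          (by norm_num; linarith)))))
      · exact .inr (.inr (.inr (.inr (hit _ (6, 4) 2 (-1) _ hs rfl (by norm_num; linarith)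
          (by norm_num; linarith)))))
    · simp only [suppGφsq, Set.mem_insert_iff, Set.mem_singleton_iff, Prod.mk.injEq] at hs
      rcases hs with hs | hs | hs | hs | hs | hs | hs | hs
      · exact .inl (hit _ (0, 0) 0 0 _ hs rfl (by norm_num; linarith) (by norm_num; linarith))
      · exact .inr (.inr (.inl (hit _ (0, 1) 0 0 _ hs rfl (by norm_num; linarith)
          (by norm_num; linarith))))
      · exact .inr (.inl (hit _ (1, 1) 0 0 _ hs rfl (by norm_num; linarith)
          (by norm_num; linarith)))
      · exact .inr (.inr (.inr (.inl (hit _ (1, 2) 0 0 _ hs rfl (by norm_num; linarith)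
          (by norm_num; linarith)))))
      · exact .inr (.inr (.inl (hit _ (2, 2) 1 0 _ hs rfl (by norm_num; linarith)
          (by norm_num; linarith))))
      · exact .inr (.inl (hit _ (3, 2) 1 0 _ hs rfl (by norm_num; linarith)
          (by norm_num; linarith)))
      · exact .inr (.inr (.inr (.inl (hit _ (3, 3) 1 0 _ hs rfl (by norm_num; linarith)
          (by norm_num; linarith)))))
      · exact .inr (.inr (.inr (.inr (hit _ (4, 3) 1 (-1) _ hs rfl (by norm_num; linarith)
          (by norm_num; linarith)))))

/-- A point of the base segment whose parameter lies in `ℤ[φ]` is in the orbit of the origin. -/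
theorem exists_π_eq_π_ι {t : ℝ} (ht : t ∈ goldenIntegers) :
    ∃ n : ℤ × ℤ, π (φ - 1 + t * (2 - φ), t) = π (ι n) := by
  obtain ⟨a, b, rfl⟩ := ht
  refine ⟨(2 * a - 2 * b - 1, a - 3 * b), (π_eq_iff.2 ⟨1 + b - a, b, ?_⟩).symm⟩
  ext <;> simp only [ι] <;> push_cast
  · linear_combination -(b : ℝ) * phi_sq
  · ring

/-- Statement: the structure of the Conway worm through a point p of T lying on the Δ-line of slope φ² from (φ−1,0) to (1,1), not in the R₀-orbit of 0, is given by the sturmian sequence of B and G patterns encoded by the mechanical sets H_{α,ρ} and V_{α,ρ} with α = 2−φ and ρ = dist(p,P)/|PQ|. -/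
theorem conway_worm_slope_phi_sq
    (q : ℝ × ℝ) (hq : q ∈ segment ℝ (φ - 1, 0) (1, 1))
    (p : T) (hp : p = π q)
    (horb : ∀ n : ℤ × ℤ, p ≠ π (ι n))
    (ρ : ℝ) (hρ : ρ = dist q ((φ - 1, 0) : ℝ × ℝ) / dist ((φ - 1, 0) : ℝ × ℝ) ((1, 1) : ℝ × ℝ)) :
    {n : ℤ × ℤ | R₀ n p ∈ π '' Δ} =
      {n : ℤ × ℤ | ∃ a ∈ Hset (2 - φ) ρ, ∃ s ∈ suppBφsq, n = ((6) * a.1 + (-2) * a.2 + s.1, (5) * a.1 + (-1) * a.2 + s.2)} ∪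
      {n : ℤ × ℤ | ∃ a ∈ Vset (2 - φ) ρ, ∃ s ∈ suppGφsq, n = ((6) * a.1 + (-2) * a.2 + s.1, (5) * a.1 + (-1) * a.2 + s.2)} := by
  have h₁ := one_lt_phi
  have h₂ := phi_lt_two
  obtain ⟨t, ht₀, -, rfl⟩ := mem_segment_iff_exists.1 hq
  have hdist : ρ = t := by
    have hmax : max |t * (2 - φ)| |t| = t := by
      rw [abs_of_nonneg (mul_nonneg ht₀ (by linarith)), abs_of_nonneg ht₀]
      exact max_eq_right (by nlinarith)
    have hmax' : max |φ - 1 - 1| (1 : ℝ) = 1 := max_eq_right (abs_le.2 ⟨by linarith, by linarith⟩)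
    rw [hρ]
    simp only [Prod.dist_eq, Real.dist_eq]
    rw [show φ - 1 + t * (1 - (φ - 1)) - (φ - 1) = t * (2 - φ) by ring,
      show (0 : ℝ) + t * (1 - 0) - 0 = t by ring, hmax,
      show |(0 : ℝ) - 1| = 1 by norm_num, hmax', div_one]
  subst hdist
  have hpt : p = π (φ - 1 + ρ * (2 - φ), ρ) := by
    rw [hp]
    congr 2 <;> ring
  have hgold : ρ ∉ goldenIntegers := fun h =>
    let ⟨n, hn⟩ := exists_π_eq_π_ι h
    horb n (hpt.trans hn)
  ext n
  rw [Set.mem_union, Set.mem_ofPred_eq, Set.mem_ofPred_eq, Set.mem_ofPred_eq, hpt,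
    R₀_mem_image_Δ_iff hgold, hit_iff_pattern hgold, HitByPattern,
    exists_mem_Hset_iff, exists_mem_Vset_iff]

end JeandelRao
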